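/- arXiv:2602.20071 — 3 statements merged into one kernel-verified Lean document; each statement's English description precedes it below -/
import Mathlib

section
/- If n ≥ 1, Δ̂ < 1, K ≥ 2, and for every category i one has 0 < π̂₁ i, 0 < π̂₂ i and π̂₁ i + π̂₂ i < 1, then X̂ i < 0 for every i, X̂ = ∑ i, X̂ i < 1, the bias correction satisfies Ê i > 0 for every i, and hence Ê_tot = ∑ i, Ê i > 0 and Î_{πU} < Î_π. -/
/-- If `n ≥ 1`, `Δ̂ < 1`, `K ≥ 2`, and for every category `i` one has `0 < π̂₁ i`,
`0 < π̂₂ i` and `π̂₁ i + π̂₂ i < 1`, then `X̂ i < 0` for every `i`, `X̂ < 1`,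
`Ê i > 0` for every `i`, hence `∑ i, Ê i > 0` and `Î_{πU} < Î_π`. -/
theorem bias_correction_positive
    (K : ℕ) (hK : 2 ≤ K) (n : ℕ) (hn : 1 ≤ n)
    (Δhat : ℝ) (hΔhat : Δhat < 1)
    (π₁hat π₂hat : Fin K → ℝ)
    (hπ : ∀ i, 0 < π₁hat i ∧ 0 < π₂hat i ∧ π₁hat i + π₂hat i < 1)
    (Xhat : Fin K → ℝ)
    (hXhat : ∀ i, Xhat i = π₁hat i * π₂hat i / (π₁hat i + π₂hat i - 1))
    (X : ℝ) (hX : X = ∑ i, Xhat i)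
    (Ehat : Fin K → ℝ)
    (hEhat : ∀ i, Ehat i = (1 / ((n : ℝ) * (1 - Δhat))) *
      (π₁hat i * π₂hat i - Xhat i * (X - Xhat i) / (X - 1)))
    (Iπ IπU : ℝ) (hIπ : Iπ = ∑ i, π₁hat i * π₂hat i) (hIπU : IπU = Iπ - ∑ i, Ehat i) :
    (∀ i, Xhat i < 0) ∧ X < 1 ∧ (∀ i, 0 < Ehat i) ∧ (0 < ∑ i, Ehat i) ∧ IπU < Iπ := by
  have hneg : ∀ i, Xhat i < 0 := by
    intro i
    obtain ⟨h1, h2, h3⟩ := hπ i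
    rw [hXhat i]
    exact div_neg_of_pos_of_neg (mul_pos h1 h2) (by linarith)
  have hle : ∀ i, X ≤ Xhat i := by
    intro i
    have h := Finset.add_sum_erase Finset.univ Xhat (Finset.mem_univ i)
    have h' : ∑ j ∈ Finset.univ.erase i, Xhat j ≤ 0 :=
      Finset.sum_nonpos (fun j _ => (hneg j).le)
    rw [hX]
    linarith
  have hX1 : X < 1 := by
    have := hle ⟨0, by omega⟩
    have := hneg ⟨0, by omega⟩
    linarith
  have hE : ∀ i, 0 < Ehat i := by
    intro i
    obtain ⟨h1, h2, h3⟩ := hπ i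
    rw [hEhat i]
    have hn' : (0 : ℝ) < n := by exact_mod_cast hn
    have hp : 0 < π₁hat i * π₂hat i := mul_pos h1 h2
    have hq : Xhat i * (X - Xhat i) / (X - 1) ≤ 0 :=
      div_nonpos_of_nonneg_of_nonpos
        (mul_nonneg_of_nonpos_of_nonpos (hneg i).le (by linarith [hle i])) (by linarith)
    exact mul_pos (one_div_pos.mpr (mul_pos hn' (by linarith))) (by linarith)
  have hS : 0 < ∑ i, Ehat i :=
    Finset.sum_pos (fun i _ => hE i) ⟨⟨0, by omega⟩, Finset.mem_univ _⟩
  exact ⟨hneg, hX1, hE, hS, by linarith⟩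
end

section
/- Under the delta agreement model, for a fixed category s (with 1 - Δ ≠ 0, T_s = π₁ s + π₂ s - 1 ≠ 0, X - 1 ≠ 0, and for every i: π₁ i ≠ 0, π₂ i ≠ 0, π₁ i + π₂ i ≠ 1), the partial-derivative coefficients f and g satisfy ∑ i, ∑ j, f i j * p i j = 0 and ∑ i, ∑ j, g i j * p i j = 0, where f i j = -(if i = j then 0 else 1) / ((1 - Δ) * T_s) * ((if s = i then 1 - π₁ s else 0) + (if s = j then π₁ s else 0) + (π₁ s * (1 - π₁ s) / (X - 1)) * (1 - X_i / π₁ i - X_j / π₂ j)) and g i j = -(if i = j then 0 else 1) / ((1 - Δ) * T_s) * ((if s = i then π₂ s else 0) + (if s = j then 1 - π₂ s else 0) + (π₂ s * (1 - π₂ s) / (X - 1)) * (1 - X_i / π₁ i - X_j / π₂ j)). -/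
lemma delta_aux (K : ℕ) (u v x : Fin K → ℝ) (hu : ∑ i, u i = 1) (hv : ∑ i, v i = 1)
    (hx : ∀ i, x i * (u i + v i) = u i * v i + x i) (X : ℝ) (hX : X = ∑ i, x i)
    (hu0 : ∀ i, u i ≠ 0) (hv0 : ∀ i, v i ≠ 0) (s : Fin K) (a b C D : ℝ)
    (α : Fin K → ℝ) (B : ℝ)
    (h0 : a * u s * (1 - v s) + b * v s * (1 - u s) + C * (1 - X) = 0) :
    ∑ i, ∑ j, (-(if i = j then (0 : ℝ) else 1) / D *
      ((if s = i then a else 0) + (if s = j then b else 0) +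
        C * (1 - x i / u i - x j / v j))) *
      ((if i = j then α i else 0) + B * u i * v j) = 0 := by
  have cell : ∀ i j, (-(if i = j then (0 : ℝ) else 1) / D *
      ((if s = i then a else 0) + (if s = j then b else 0) +
        C * (1 - x i / u i - x j / v j))) *
      ((if i = j then α i else 0) + B * u i * v j) =
      (-(B / D)) * ((((if s = i then a * u i else 0) + C * (u i - x i)) * v j
        + u i * (if s = j then b * v j else 0) - (C * u i) * x j)
        - (if i = j then (if s = i then (a + b) * u i * v i else 0) - C * x i else 0)) := by
    intro i j
    have h1 : x i / u i * u i = x i := div_mul_cancel₀ _ (hu0 i)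
    have h2 : x j / v j * v j = x j := div_mul_cancel₀ _ (hv0 j)
    by_cases hij : i = j
    · subst hij
      have := hx i
      simp only [if_true]
      split_ifs <;> linear_combination (-(B / D)) * C * this
    · simp only [hij, if_false]
      split_ifs <;> linear_combination (B / D) * C * (v j * h1 + u i * h2)
  have row : ∀ i, ∑ j, (-(B / D)) * ((((if s = i then a * u i else 0) + C * (u i - x i)) * v j
        + u i * (if s = j then b * v j else 0) - (C * u i) * x j)
        - (if i = j then (if s = i then (a + b) * u i * v i else 0) - C * x i else 0))
      = (-(B / D)) * ((if s = i then a * u i - (a + b) * u i * v i else 0)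
        + (b * v s + C * (1 - X)) * u i) := by
    intro i
    rw [← Finset.mul_sum, Finset.sum_sub_distrib, Finset.sum_sub_distrib,
      Finset.sum_add_distrib, ← Finset.mul_sum, ← Finset.mul_sum, ← Finset.mul_sum, hv, ← hX,
      Finset.sum_ite_eq, Finset.sum_ite_eq]
    simp only [Finset.mem_univ, if_true]
    split_ifs <;> ring
  simp_rw [cell, row]
  rw [← Finset.mul_sum, Finset.sum_add_distrib, ← Finset.mul_sum, hu, Finset.sum_ite_eq]
  simp only [Finset.mem_univ, if_true]
  linear_combination (-(B / D)) * h0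

/-- Under the delta agreement model, for a fixed category `s`, the partial-derivative
coefficients `f` and `g` satisfy `∑ i, ∑ j, f i j * p i j = 0` and
`∑ i, ∑ j, g i j * p i j = 0`. -/
theorem delta_model_derivative_sums_vanish
    (K : ℕ) (hK : 2 ≤ K)
    (α π₁ π₂ : Fin K → ℝ)
    (hπ₁sum : ∑ i, π₁ i = 1) (hπ₂sum : ∑ i, π₂ i = 1)
    (Δ : ℝ) (hΔdef : Δ = ∑ i, α i)
    (p : Fin K → Fin K → ℝ)
    (hp : ∀ i j, p i j = (if i = j then α i else 0) + (1 - Δ) * π₁ i * π₂ j)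
    (Xf : Fin K → ℝ) (hXf : ∀ i, Xf i = π₁ i * π₂ i / (π₁ i + π₂ i - 1))
    (X : ℝ) (hX : X = ∑ i, Xf i)
    (s : Fin K) (Ts : ℝ) (hTs : Ts = π₁ s + π₂ s - 1)
    (hΔ1 : 1 - Δ ≠ 0) (hTs0 : Ts ≠ 0) (hX1 : X - 1 ≠ 0)
    (hπ₁0 : ∀ i, π₁ i ≠ 0) (hπ₂0 : ∀ i, π₂ i ≠ 0) (hsum1 : ∀ i, π₁ i + π₂ i ≠ 1)
    (f g : Fin K → Fin K → ℝ)
    (hf : ∀ i j, f i j = -(if i = j then (0 : ℝ) else 1) / ((1 - Δ) * Ts) *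
      ((if s = i then 1 - π₁ s else 0) + (if s = j then π₁ s else 0) +
        (π₁ s * (1 - π₁ s) / (X - 1)) * (1 - Xf i / π₁ i - Xf j / π₂ j)))
    (hg : ∀ i j, g i j = -(if i = j then (0 : ℝ) else 1) / ((1 - Δ) * Ts) *
      ((if s = i then π₂ s else 0) + (if s = j then 1 - π₂ s else 0) +
        (π₂ s * (1 - π₂ s) / (X - 1)) * (1 - Xf i / π₁ i - Xf j / π₂ j))) :
    (∑ i, ∑ j, f i j * p i j = 0) ∧ (∑ i, ∑ j, g i j * p i j = 0) := by
  have hx : ∀ i, Xf i * (π₁ i + π₂ i) = π₁ i * π₂ i + Xf i := by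
    intro i
    have h : π₁ i + π₂ i - 1 ≠ 0 := sub_ne_zero.mpr (hsum1 i)
    have h2 : Xf i * (π₁ i + π₂ i - 1) = π₁ i * π₂ i := by
      rw [hXf]; exact div_mul_cancel₀ _ h
    linear_combination h2
  simp_rw [hf, hg, hp]
  constructor
  · apply delta_aux K π₁ π₂ Xf hπ₁sum hπ₂sum hx X hX hπ₁0 hπ₂0
    have h : π₁ s * (1 - π₁ s) / (X - 1) * (X - 1) = π₁ s * (1 - π₁ s) := div_mul_cancel₀ _ hX1
    linear_combination -h
  · apply delta_aux K π₁ π₂ Xf hπ₁sum hπ₂sum hx X hX hπ₁0 hπ₂0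
    have h : π₂ s * (1 - π₂ s) / (X - 1) * (X - 1) = π₂ s * (1 - π₂ s) := div_mul_cancel₀ _ hX1
    linear_combination -h
end

section
/- Under the delta agreement model, for a fixed category s (with 1 - Δ ≠ 0, T_s = π₁ s + π₂ s - 1 ≠ 0, X - 1 ≠ 0, and for every i: π₁ i ≠ 0, π₂ i ≠ 0, π₁ i + π₂ i ≠ 1), the partial-derivative coefficients f and g satisfy ∑ i, ∑ j, f i j * g i j * p i j = (1 / (1 - Δ)) * (π₁ s * π₂ s - X_s * (X - X_s) / (X - 1)), where f i j = -(if i = j then 0 else 1) / ((1 - Δ) * T_s) * ((if s = i then 1 - π₁ s else 0) + (if s = j then π₁ s else 0) + (π₁ s * (1 - π₁ s) / (X - 1)) * (1 - X_i / π₁ i - X_j / π₂ j)) and g i j = -(if i = j then 0 else 1) / ((1 - Δ) * T_s) * ((if s = i then π₂ s else 0) + (if s = j then 1 - π₂ s else 0) + (π₂ s * (1 - π₂ s) / (X - 1)) * (1 - X_i / π₁ i - X_j / π₂ j)). -/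
/-- Under the delta agreement model, for a fixed category `s`, the partial-derivative
coefficients `f` and `g` satisfy
`∑ i, ∑ j, f i j * g i j * p i j = (1 / (1 - Δ)) * (π₁ s * π₂ s - X_s * (X - X_s) / (X - 1))`. -/
theorem delta_model_covariance_sum
    (K : ℕ) (hK : 2 ≤ K)
    (α π₁ π₂ : Fin K → ℝ)
    (hπ₁sum : ∑ i, π₁ i = 1) (hπ₂sum : ∑ i, π₂ i = 1)
    (Δ : ℝ) (hΔdef : Δ = ∑ i, α i)
    (p : Fin K → Fin K → ℝ)
    (hp : ∀ i j, p i j = (if i = j then α i else 0) + (1 - Δ) * π₁ i * π₂ j)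
    (Xf : Fin K → ℝ) (hXf : ∀ i, Xf i = π₁ i * π₂ i / (π₁ i + π₂ i - 1))
    (X : ℝ) (hX : X = ∑ i, Xf i)
    (s : Fin K) (Ts : ℝ) (hTs : Ts = π₁ s + π₂ s - 1)
    (hΔ1 : 1 - Δ ≠ 0) (hTs0 : Ts ≠ 0) (hX1 : X - 1 ≠ 0)
    (hπ₁0 : ∀ i, π₁ i ≠ 0) (hπ₂0 : ∀ i, π₂ i ≠ 0) (hsum1 : ∀ i, π₁ i + π₂ i ≠ 1)
    (f g : Fin K → Fin K → ℝ)
    (hf : ∀ i j, f i j = -(if i = j then (0 : ℝ) else 1) / ((1 - Δ) * Ts) *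
      ((if s = i then 1 - π₁ s else 0) + (if s = j then π₁ s else 0) +
        (π₁ s * (1 - π₁ s) / (X - 1)) * (1 - Xf i / π₁ i - Xf j / π₂ j)))
    (hg : ∀ i j, g i j = -(if i = j then (0 : ℝ) else 1) / ((1 - Δ) * Ts) *
      ((if s = i then π₂ s else 0) + (if s = j then 1 - π₂ s else 0) +
        (π₂ s * (1 - π₂ s) / (X - 1)) * (1 - Xf i / π₁ i - Xf j / π₂ j))) :
    ∑ i, ∑ j, f i j * g i j * p i j =
      (1 / (1 - Δ)) * (π₁ s * π₂ s - Xf s * (X - Xf s) / (X - 1)) := by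
  have hT : ∀ i, π₁ i + π₂ i - 1 ≠ 0 := fun i => sub_ne_zero.mpr (hsum1 i)
  obtain ⟨w, hw⟩ : ∃ w : Fin K → Fin K → ℝ, ∀ i j, w i j = π₁ i * π₂ j - if i = j then π₁ i * π₂ j else 0 :=
    ⟨_, fun _ _ => rfl⟩
  obtain ⟨h, hh⟩ : ∃ h : Fin K → Fin K → ℝ, ∀ i j, h i j = 1 - Xf i / π₁ i - Xf j / π₂ j :=
    ⟨_, fun _ _ => rfl⟩
  have e1 : ∀ i, Xf i / π₁ i * π₁ i = Xf i := fun i => div_mul_cancel₀ _ (hπ₁0 i)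
  have e2 : ∀ i, Xf i / π₂ i * π₂ i = Xf i := fun i => div_mul_cancel₀ _ (hπ₂0 i)
  have d1 : ∀ i, (1 - Xf i / π₁ i) * (1 - π₂ i) + Xf i = 1 := by
    intro i
    have := hT i
    have := hπ₁0 i
    rw [hXf i]; field_simp; ring
  have d2 : ∀ i, (1 - Xf i / π₂ i) * (1 - π₁ i) + Xf i = 1 := by
    intro i
    have := hT i
    have := hπ₂0 i
    rw [hXf i]; field_simp; ring
  have R1 : ∀ i, ∑ j, w i j = π₁ i * (1 - π₂ i) := by
    intro i
    simp only [hw, Finset.sum_sub_distrib, ← Finset.mul_sum, hπ₂sum, Finset.sum_ite_eq, Finset.mem_univ, if_true]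
    ring
  have R1' : ∀ j, ∑ i, w i j = π₂ j * (1 - π₁ j) := by
    intro j
    simp only [hw, Finset.sum_sub_distrib, ← Finset.sum_mul, hπ₁sum, Finset.sum_ite_eq', Finset.mem_univ, if_true]
    ring
  have R2 : ∀ i, ∑ j, h i j * w i j = π₁ i * (1 - X) := by
    intro i
    have : ∀ j, h i j * w i j = π₁ i * (1 - Xf i / π₁ i) * π₂ j - π₁ i * Xf j
        - if i = j then h i j * (π₁ i * π₂ j) else 0 := by
      intro j
      rw [hw, mul_sub, mul_ite, mul_zero, hh]
      linear_combination (-π₁ i) * e2 j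
    simp only [this, Finset.sum_sub_distrib, ← Finset.mul_sum, hπ₂sum, ← hX, Finset.sum_ite_eq, Finset.mem_univ, if_true]
    rw [hh]
    linear_combination π₁ i * d1 i + π₁ i * e2 i
  have R2' : ∀ j, ∑ i, h i j * w i j = π₂ j * (1 - X) := by
    intro j
    have : ∀ i, h i j * w i j = π₂ j * (1 - Xf j / π₂ j) * π₁ i - π₂ j * Xf i
        - if i = j then h i j * (π₁ i * π₂ j) else 0 := by
      intro i
      rw [hw, mul_sub, mul_ite, mul_zero, hh]
      linear_combination (-π₂ j) * e1 i
    simp only [this, Finset.sum_sub_distrib, ← Finset.mul_sum, hπ₁sum, ← hX, Finset.sum_ite_eq', Finset.mem_univ, if_true]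
    rw [hh]
    linear_combination π₂ j * d2 j + π₂ j * e1 j
  have R3 : ∑ i, ∑ j, h i j * (h i j * w i j) = (1 - X) * (1 - 2 * X) := by
    have : ∀ i j, h i j * (h i j * w i j) =
        (1 - Xf i / π₁ i) * (h i j * w i j) - Xf j / π₂ j * (h i j * w i j) := by
      intro i j
      rw [hh]; ring
    simp only [this, Finset.sum_sub_distrib]
    rw [Finset.sum_comm (f := fun i j => Xf j / π₂ j * (h i j * w i j))]
    simp only [← Finset.mul_sum, R2, R2']
    have t1 : ∀ i, (1 - Xf i / π₁ i) * (π₁ i * (1 - X)) = (π₁ i - Xf i) * (1 - X) := by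
      intro i; linear_combination (-(1 - X)) * e1 i
    have t2 : ∀ i, Xf i / π₂ i * (π₂ i * (1 - X)) = Xf i * (1 - X) := by
      intro i; linear_combination (1 - X) * e2 i
    simp only [t1, t2, ← Finset.sum_mul, Finset.sum_sub_distrib, hπ₁sum, ← hX]
    ring
  have key : ∀ i j, f i j * g i j * p i j = 1 / ((1 - Δ) * Ts ^ 2) *
      ((if s = i then (1 - π₁ s) * π₂ s * w i j else 0)
      + (if s = j then π₁ s * (1 - π₂ s) * w i j else 0)
      + (if s = i then ((1 - π₁ s) * (π₂ s * (1 - π₂ s) / (X - 1))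
          + π₂ s * (π₁ s * (1 - π₁ s) / (X - 1))) * (h i j * w i j) else 0)
      + (if s = j then (π₁ s * (π₂ s * (1 - π₂ s) / (X - 1))
          + (1 - π₂ s) * (π₁ s * (1 - π₁ s) / (X - 1))) * (h i j * w i j) else 0)
      + (π₁ s * (1 - π₁ s) / (X - 1)) * (π₂ s * (1 - π₂ s) / (X - 1)) *
          (h i j * (h i j * w i j))) := by
    intro i j
    rw [hf, hg, hp, ← hh, hw]
    by_cases hij : i = j
    · simp [hij]
    · by_cases hi : s = i
      · have hj : s ≠ j := fun e => hij (hi.symm.trans e)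
        simp only [if_neg hij, if_pos hi, if_neg hj]
        field_simp
        ring
      · by_cases hj : s = j
        · simp only [if_neg hij, if_neg hi, if_pos hj]
          field_simp
          ring
        · simp only [if_neg hij, if_neg hi, if_neg hj]
          field_simp
          ring
  have c1 : ∀ (c : ℝ) (φ : Fin K → Fin K → ℝ),
      ∑ i, ∑ j, (if s = i then c * φ i j else 0) = c * ∑ j, φ s j := by
    intro c φ
    rw [Finset.sum_comm]
    simp [Finset.mul_sum]
  have c2 : ∀ (c : ℝ) (φ : Fin K → Fin K → ℝ),
      ∑ i, ∑ j, (if s = j then c * φ i j else 0) = c * ∑ i, φ i s := by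
    intro c φ
    simp [Finset.mul_sum]
  simp only [key, ← Finset.mul_sum, Finset.sum_add_distrib]
  rw [c1 _ w, c2 _ w, c1 _ (fun i j => h i j * w i j), c2 _ (fun i j => h i j * w i j), R3]
  simp only [R1, R1', R2, R2']
  have hXs : Xf s = π₁ s * π₂ s / Ts := by rw [hXf, hTs]
  rw [hXs]
  field_simp
  rw [hTs]
  ring
end
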